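/- Let 𝔤 be the contact Lie superalgebra of odd type 𝔪 or the special contact Lie superalgebra of odd type 𝔰𝔪(κ) over F. For any χ ∈ 𝔤_{0̄}^* with ht(χ) ≥ 2 and any automorphism Φ ∈ Aut(𝔤), one has rank(Φ·χ) = rank(χ). -/

import Mathlib

/-!
Abstract framework modelling the contact Lie superalgebra of odd type `𝔪`
(and the special contact Lie superalgebra of odd type `𝔰𝔪(κ)`) over an
algebraically closed field `F` of characteristic `p > 3`, together with
χ-reduced representations and χ-reduced Kac modules, following the paper
"Non-restricted representations of contact and special contact Lie
superalgebras of odd type".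
-/

open scoped BigOperators

universe u v

/-- The condition for a `(2n+1)`-tuple of exponents to lie in `I(n, n+1)`:
`r_i < p` for the first `n` (even) slots and `r_i ∈ {0,1}` for the
remaining `n+1` (odd) slots. -/
def IsIdx (p n : ℕ) (r : Fin (2 * n + 1) → ℕ) : Prop :=
  (∀ i : Fin (2 * n + 1), (i : ℕ) < n → r i < p) ∧
    (∀ i : Fin (2 * n + 1), n ≤ (i : ℕ) → r i ≤ 1)

/-- `‖r‖ = Σ_{k=1}^{n} r_k + Σ_{k=1}^{n} r_{k'} + 2 r_{2n+1}`. -/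
def normIdx (n : ℕ) (r : Fin (2 * n + 1) → ℕ) : ℕ :=
  (∑ i, r i) + r ⟨2 * n, by omega⟩

/-- Abstract model of the contact Lie superalgebra of odd type `𝔪` or of the
special contact Lie superalgebra of odd type `𝔰𝔪(κ)`, over an algebraically
closed field `F` of characteristic `p > 3`: a finite-dimensional restricted
Lie superalgebra `g = even ⊕ odd` with super bracket `br`, with its standard
`ℤ`-grading `gr` supported in degrees `≥ -2`, `p`-mapping `pMap`, the ordered
basis `M_{x_1}, …, M_{x_{2n}}` of `g_{[-1]}` (the unprimed `M_{x_i}`, `i ≤ n`,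
being odd and the primed ones even), the element `M_1` spanning `g_{[-2]}`,
the toral elements `h_j` and the nilpotent parts `𝔫₊, 𝔫₋` of `g_{[0]}`. -/
structure OddContactSetup (F : Type u) [Field F] (g : Type v)
    [AddCommGroup g] [Module F g] where
  p : ℕ
  n : ℕ
  hp : p.Prime
  hp3 : 3 < p
  hchar : CharP F p
  halg : IsAlgClosed F
  hn : 0 < n
  findim : FiniteDimensional F g
  /-- the super bracket -/
  br : g →ₗ[F] g →ₗ[F] g
  /-- the even part `g₀` -/
  even : Submodule F g
  /-- the odd part `g₁` -/
  odd : Submodule F g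
  hcompl : IsCompl even odd
  br_ee : ∀ x ∈ even, ∀ y ∈ even, br x y ∈ even
  br_eo : ∀ x ∈ even, ∀ y ∈ odd, br x y ∈ odd
  br_oe : ∀ x ∈ odd, ∀ y ∈ even, br x y ∈ odd
  br_oo : ∀ x ∈ odd, ∀ y ∈ odd, br x y ∈ even
  /-- the standard `ℤ`-grading `g = ⊕_{i ≥ -2} g_{[i]}` -/
  gr : ℤ → Submodule F g
  gr_bot : ∀ i : ℤ, i < -2 → gr i = ⊥
  gr_internal : DirectSum.IsInternal gr
  gr_br : ∀ (i j : ℤ), ∀ x ∈ gr i, ∀ y ∈ gr j, br x y ∈ gr (i + j)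
  /-- the `p`-mapping (the `p`-th associative power on the even part) -/
  pMap : g → g
  pMap_even : ∀ x ∈ even, pMap x ∈ even
  pMap_gr : ∀ (i : ℤ), ∀ x ∈ gr i, x ∈ even → pMap x ∈ gr ((p : ℤ) * i)
  /-- the basis elements `M_{x_1}, …, M_{x_n}, M_{x_{1'}}, …, M_{x_{n'}}` of
  `g_{[-1]}` (0-based: index `j < n` is `M_{x_{j+1}}`, index `n + j` is
  `M_{x_{(j+1)'}}`) -/
  Mx : Fin (2 * n) → g
  /-- the element `M_1` spanning `g_{[-2]}` -/
  M1 : g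
  Mx_gr : ∀ j, Mx j ∈ gr (-1)
  M1_gr : M1 ∈ gr (-2)
  Mx_odd : ∀ j : Fin (2 * n), (j : ℕ) < n → Mx j ∈ odd
  Mx_even : ∀ j : Fin (2 * n), n ≤ (j : ℕ) → Mx j ∈ even
  M1_odd : M1 ∈ odd
  Mx_basis : Submodule.span F (Set.range Mx) = gr (-1)
  Mx_indep : LinearIndependent F Mx
  M1_span : Submodule.span F {M1} = gr (-2)
  M1_ne : M1 ≠ 0
  /-- the Cartan elements `h_j = M_{x^{(ε_j+ε_{j'})} - x^{(ε_{j+1}+ε_{(j+1)'})}}`,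
  `j = 1, …, n-1` -/
  hgen : Fin (n - 1) → g
  hgen_gr : ∀ j, hgen j ∈ gr 0
  hgen_even : ∀ j, hgen j ∈ even
  /-- `𝔫⁺_{[0]}` -/
  nplus : Submodule F g
  /-- `𝔫⁻_{[0]}` -/
  nminus : Submodule F g
  nplus_le : nplus ≤ gr 0
  nminus_le : nminus ≤ gr 0

namespace OddContactSetup

variable {F : Type u} [Field F] {g : Type v} [AddCommGroup g] [Module F g]
variable (S : OddContactSetup F g)

/-- The filtration `g^i = Σ_{j ≥ i} g_{[j]}`. -/
def filt (i : ℤ) : Submodule F g := ⨆ j ≥ i, S.gr j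

/-- The height `ht(χ) = min { i | χ(g^i) = 0 }` of a `p`-character `χ`. -/
noncomputable def ht (χ : Module.Dual F g) : ℤ :=
  sInf {i : ℤ | ∀ x ∈ S.filt i, χ x = 0}

/-- The index set for the PBW monomials
`X^s = M_{x_{1'}}^{s_{1'}} ⋯ M_{x_{n'}}^{s_{n'}} M_{x_n}^{s_n} ⋯ M_{x_1}^{s_1} M_1^{s_{2n+1}}`:
`s.1` records the exponents `s_{1'}, …, s_{n'}` (each in `{0, …, p-1}`),
`s.2.1` the exponents `s_1, …, s_n` (each in `{0,1}`) and `s.2.2 = s_{2n+1}`. -/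
abbrev SIdx : Type :=
  (Fin S.n → Fin S.p) × (Fin S.n → Fin 2) × Fin 2

/-- `|s| = Σ_{i=1}^n (s_i + s_{i'}) + s_{2n+1}`. -/
def sdeg (s : S.SIdx) : ℕ :=
  (∑ i, (s.1 i : ℕ)) + (∑ i, (s.2.1 i : ℕ)) + (s.2.2 : ℕ)

/-- The coordinate `s_j`, `j = 1, …, 2n` (0-based), of the tuple `s`. -/
def sCoord (s : S.SIdx) (j : Fin (2 * S.n)) : ℕ :=
  if h : (j : ℕ) < S.n then (s.2.1 ⟨(j : ℕ), h⟩ : ℕ)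
  else (s.1 ⟨(j : ℕ) - S.n, by have := j.isLt; omega⟩ : ℕ)

/-- A `u_χ(g)`-module structure on `V`: a representation of the restricted
Lie superalgebra `g` with `p`-character `χ`. -/
structure Rep (χ : Module.Dual F g) (V : Type v) [AddCommGroup V] [Module F V] where
  ρ : g →ₗ[F] Module.End F V
  comm_left : ∀ x y : g, x ∈ S.even → ρ (S.br x y) = ρ x * ρ y - ρ y * ρ x
  comm_right : ∀ x y : g, y ∈ S.even → ρ (S.br x y) = ρ x * ρ y - ρ y * ρ x
  anti : ∀ x y : g, x ∈ S.odd → y ∈ S.odd → ρ (S.br x y) = ρ x * ρ y + ρ y * ρ x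
  pchar : ∀ x ∈ S.even, (ρ x) ^ S.p = ρ (S.pMap x) + (χ x) ^ S.p • (1 : Module.End F V)

/-- A `u_χ(hsub)`-module structure on `W`, for a subalgebra `hsub ≤ g`. -/
structure SubRep (hsub : Submodule F g) (χ : Module.Dual F g) (W : Type v)
    [AddCommGroup W] [Module F W] where
  ρ : hsub →ₗ[F] Module.End F W
  comm_left : ∀ x y : hsub, (x : g) ∈ S.even →
      ∀ hm : S.br (x : g) (y : g) ∈ hsub,
      ρ ⟨S.br (x : g) (y : g), hm⟩ = ρ x * ρ y - ρ y * ρ x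
  comm_right : ∀ x y : hsub, (y : g) ∈ S.even →
      ∀ hm : S.br (x : g) (y : g) ∈ hsub,
      ρ ⟨S.br (x : g) (y : g), hm⟩ = ρ x * ρ y - ρ y * ρ x
  anti : ∀ x y : hsub, (x : g) ∈ S.odd → (y : g) ∈ S.odd →
      ∀ hm : S.br (x : g) (y : g) ∈ hsub,
      ρ ⟨S.br (x : g) (y : g), hm⟩ = ρ x * ρ y + ρ y * ρ x
  pchar : ∀ x : hsub, (x : g) ∈ S.even → ∀ hm : S.pMap (x : g) ∈ hsub,
      (ρ x) ^ S.p = ρ ⟨S.pMap (x : g), hm⟩ + (χ (x : g)) ^ S.p • (1 : Module.End F W)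

variable {S}

/-- A submodule `W ≤ V` of a `u_χ(g)`-module is invariant under a subalgebra
`hsub ≤ g`. -/
def Rep.SubInvariant {χ : Module.Dual F g} {V : Type v} [AddCommGroup V] [Module F V]
    (r : Rep S χ V) (hsub : Submodule F g) (W : Submodule F V) : Prop :=
  ∀ x ∈ hsub, ∀ v ∈ W, r.ρ x v ∈ W

/-- `W` is a simple `u_χ(hsub)`-submodule of the `u_χ(g)`-module `V`. -/
def Rep.SubSimple {χ : Module.Dual F g} {V : Type v} [AddCommGroup V] [Module F V]
    (r : Rep S χ V) (hsub : Submodule F g) (W : Submodule F V) : Prop :=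
  W ≠ ⊥ ∧ r.SubInvariant hsub W ∧
    ∀ W' ≤ W, r.SubInvariant hsub W' → W' = ⊥ ∨ W' = W

/-- Simplicity of a `u_χ(g)`-module. -/
def Rep.IsSimple {χ : Module.Dual F g} {V : Type v} [AddCommGroup V] [Module F V]
    (r : Rep S χ V) : Prop :=
  (⊤ : Submodule F V) ≠ ⊥ ∧
    ∀ W : Submodule F V, r.SubInvariant ⊤ W → W = ⊥ ∨ W = ⊤

/-- Invariance of a subspace of a `u_χ(hsub)`-module. -/
def SubRep.Invariant {hsub : Submodule F g} {χ : Module.Dual F g} {W : Type v}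
    [AddCommGroup W] [Module F W] (m : SubRep S hsub χ W) (W' : Submodule F W) : Prop :=
  ∀ x : hsub, ∀ w ∈ W', m.ρ x w ∈ W'

/-- Simplicity of a `u_χ(hsub)`-module. -/
def SubRep.IsSimple {hsub : Submodule F g} {χ : Module.Dual F g} {W : Type v}
    [AddCommGroup W] [Module F W] (m : SubRep S hsub χ W) : Prop :=
  (⊤ : Submodule F W) ≠ ⊥ ∧ ∀ W' : Submodule F W, m.Invariant W' → W' = ⊥ ∨ W' = ⊤

/-- The operator
`X^s = M_{x_{1'}}^{s_{1'}} ⋯ M_{x_{n'}}^{s_{n'}} M_{x_n}^{s_n} ⋯ M_{x_1}^{s_1} M_1^{s_{2n+1}}`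
acting on a `u_χ(g)`-module. -/
noncomputable def Xop {χ : Module.Dual F g} {V : Type v} [AddCommGroup V] [Module F V]
    (r : Rep S χ V) (s : S.SIdx) : Module.End F V :=
  (List.ofFn fun i : Fin S.n =>
      (r.ρ (S.Mx ⟨S.n + (i : ℕ), by have := i.isLt; omega⟩)) ^ ((s.1 i : ℕ))).prod *
  (List.ofFn fun i : Fin S.n =>
      (r.ρ (S.Mx ⟨S.n - 1 - (i : ℕ), by have := i.isLt; omega⟩)) ^
        ((s.2.1 ⟨S.n - 1 - (i : ℕ), by have := i.isLt; omega⟩ : Fin 2) : ℕ)).prod *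
  (r.ρ S.M1) ^ ((s.2.2 : ℕ))

/-- Isomorphism of `u_χ(g)`-modules. -/
def RepIso {χ : Module.Dual F g} {V V' : Type v} [AddCommGroup V] [Module F V]
    [AddCommGroup V'] [Module F V'] (r : Rep S χ V) (r' : Rep S χ V') : Prop :=
  ∃ e : V ≃ₗ[F] V', ∀ (x : g) (v : V), e (r.ρ x v) = r'.ρ x (e v)

/-- Isomorphism of `u_χ(hsub)`-modules. -/
def SubRepIso {hsub : Submodule F g} {χ : Module.Dual F g} {W W' : Type v}
    [AddCommGroup W] [Module F W] [AddCommGroup W'] [Module F W']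
    (m : SubRep S hsub χ W) (m' : SubRep S hsub χ W') : Prop :=
  ∃ e : W ≃ₗ[F] W', ∀ (x : hsub) (w : W), e (m.ρ x w) = m'.ρ x (e w)

/-- The coadjoint action `(Φ·χ)(x) = χ(Φ⁻¹ x)`. -/
def coad (Φ : g ≃ₗ[F] g) (χ : Module.Dual F g) : Module.Dual F g :=
  χ ∘ₗ Φ.symm.toLinearMap

variable (S)

/-- The `χ`-reduced Kac module `K_χ(M) = u_χ(g) ⊗_{u_χ(g^0)} M` associated
with a `u_χ(g^0)`-module `M`:  a `u_χ(g)`-module `V` together with a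
`g^0`-equivariant map `ι : M → V` (`w ↦ 1 ⊗ w`), such that by the PBW theorem
every element of `V` is uniquely of the form `Σ_s X^s ⊗ v(s)`, and satisfying
the universal property of the induced module. -/
structure KacModule (χ : Module.Dual F g) {W : Type v} [AddCommGroup W] [Module F W]
    (M : SubRep S (S.filt 0) χ W) (V : Type v) [AddCommGroup V] [Module F V] where
  rep : Rep S χ V
  ι : W →ₗ[F] V
  equivariant : ∀ (x : S.filt 0) (w : W), ι (M.ρ x w) = rep.ρ (x : g) (ι w)
  pbw : Function.Bijective fun vc : S.SIdx → W =>
    ∑ s : S.SIdx, Xop rep s (ι (vc s))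
  universal : ∀ (V' : Type v) [AddCommGroup V'] [Module F V'] (r' : Rep S χ V')
      (f : W →ₗ[F] V'),
      (∀ (x : S.filt 0) (w : W), f (M.ρ x w) = r'.ρ (x : g) (f w)) →
      ∃! φ : V →ₗ[F] V',
        (∀ (x : g) (v : V), φ (rep.ρ x v) = r'.ρ x (φ v)) ∧ φ ∘ₗ ι = f

/-- The linear map `u ↦ (χ([u, M_{x_1}]), …, χ([u, M_{x_{2n}}]))` used to
define `rank(χ)`. -/
noncomputable def chiMap (χ : Module.Dual F g) : g →ₗ[F] (Fin (2 * S.n) → F) :=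
  LinearMap.pi fun j => χ ∘ₗ (S.br.flip (S.Mx j))

open Classical in
/-- `rank(χ)`: the rank (for `h = ht(χ)`) of the matrix
`χ((f_1,…,f_k)ᵗ(M_{x_1},…,M_{x_{2n}})) ⊕ χ((g_1,…,g_l)ᵗ(M_1))` for bases
`{f_i}` of `g_{[h]}` and `{g_i}` of `g_{[h+1]}` (stated basis-freely). -/
noncomputable def rankChi (χ : Module.Dual F g) : ℕ :=
  Module.finrank F (Submodule.map (S.chiMap χ) (S.gr (S.ht χ))) +
    (if ∃ u ∈ S.gr (S.ht χ + 1), χ (S.br u S.M1) ≠ 0 then 1 else 0)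

/-- `χ` (with `ht(χ) ≥ 2`) is nonsingular if `rank(χ) = 2n + 1`. -/
def Nonsingular (χ : Module.Dual F g) : Prop :=
  2 ≤ S.ht χ ∧ S.rankChi χ = 2 * S.n + 1

/-- Automorphisms of the Lie superalgebra `g` (they preserve the parity and
the filtration). -/
structure IsAut (Φ : g ≃ₗ[F] g) : Prop where
  map_br : ∀ x y : g, Φ (S.br x y) = S.br (Φ x) (Φ y)
  map_even : ∀ x ∈ S.even, Φ x ∈ S.even
  map_odd : ∀ x ∈ S.odd, Φ x ∈ S.odd
  map_filt : ∀ i : ℤ, Submodule.map Φ.toLinearMap (S.filt i) = S.filt i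

/-- `Aut*(g)`: automorphisms preserving each graded piece. -/
def IsAutStar (Φ : g ≃ₗ[F] g) : Prop :=
  S.IsAut Φ ∧ ∀ i : ℤ, Submodule.map Φ.toLinearMap (S.gr i) = S.gr i


/-- `χ` (with `ht(χ) = h ≥ 5` and `rank(χ) = r + 1 < 2n + 1`) is
`Δ`-invertible (Definition 2.6 of the paper). -/
def DeltaInvertible (χ : Module.Dual F g) : Prop :=
  ∃ (r : ℕ) (hr : r + 1 < 2 * S.n + 1),
    5 ≤ S.ht χ ∧ S.rankChi χ = r + 1 ∧
    ∃ Φ : g ≃ₗ[F] g, S.IsAutStar Φ ∧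
      ∃ σ : Equiv.Perm (Fin (2 * S.n)),
        -- (2): the matrix `(Φ·χ)((f_1,…,f_k)ᵗ(M_{x_{i_1}},…,M_{x_{i_r}}))`
        -- has an invertible `r × r` minor (i.e. has full rank `r`)
        Submodule.map
            (LinearMap.pi fun b : Fin r =>
              (coad Φ χ) ∘ₗ S.br.flip
                (S.Mx (σ ⟨(b : ℕ), by have := b.isLt; omega⟩)))
            (S.gr (S.ht χ)) = ⊤ ∧
        -- (3): `(Φ·χ)([g_{[h]}, M_{x_j}]) = 0` for `j ∈ J`
        (∀ b : Fin (2 * S.n), r ≤ (b : ℕ) → ∀ u ∈ S.gr (S.ht χ),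
          coad Φ χ (S.br u (S.Mx (σ b))) = 0) ∧
        -- (4),(5): a `g_{[0]}`-submodule `Δ ⊆ g_{[h-1]}` killed by `Φ·χ`,
        -- containing homogeneous `e_{r+1}, …, e_{2n}` with
        -- `(Φ·χ)((e_{r+1},…,e_{2n})ᵗ(M_{x_{i_{r+1}}},…,M_{x_{i_{2n}}}))` invertible
        ∃ D : Submodule F g, D ≤ S.gr (S.ht χ - 1) ∧
          (∀ x ∈ S.gr 0, ∀ d ∈ D, S.br x d ∈ D) ∧
          (∀ d ∈ D, coad Φ χ d = 0) ∧
          ∃ e : Fin (2 * S.n - r) → g,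
            (∀ b, e b ∈ D) ∧ (∀ b, e b ∈ S.even ∨ e b ∈ S.odd) ∧
            IsUnit (Matrix.det (Matrix.of fun a b : Fin (2 * S.n - r) =>
              coad Φ χ (S.br (e a)
                (S.Mx (σ ⟨r + (b : ℕ), by have := b.isLt; omega⟩)))))

/-- `χ` with `ht(χ) = 1` is regular semisimple (Definition 3.2). -/
def RegularSemisimple (χ : Module.Dual F g) : Prop :=
  S.ht χ = 1 ∧
    ∃ Φ : g ≃ₗ[F] g, S.IsAut Φ ∧
      (∀ x ∈ S.nplus, coad Φ χ x = 0) ∧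
      (∀ x ∈ S.nminus, coad Φ χ x = 0) ∧
      (∀ j : Fin (S.n - 1), coad Φ χ (S.hgen j) ≠ 0) ∧
      coad Φ χ (∑ j : Fin (S.n - 1), S.hgen j) ≠ 0

end OddContactSetup

/-- The contact Lie superalgebra of odd type `𝔪` itself: an `OddContactSetup`
together with its standard basis `{M_{x^{(r)}} | r ∈ I(n, n+1)}` of monomial
elements, compatible with the grading and with `Mx`, `M1`. -/
structure ContactSetup (F : Type u) [Field F] (g : Type v)
    [AddCommGroup g] [Module F g] extends OddContactSetup F g where
  /-- the standard basis element `M_{x^{(r)}}` -/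
  Mmon : (Fin (2 * n + 1) → ℕ) → g
  Mmon_gr : ∀ r, IsIdx p n r → Mmon r ∈ gr ((normIdx n r : ℤ) - 2)
  Mmon_indep : LinearIndependent F fun r : { r // IsIdx p n r } => Mmon r.1
  Mmon_span : Submodule.span F (Set.range fun r : { r // IsIdx p n r } => Mmon r.1) = ⊤
  Mmon_gr_span : ∀ i : ℤ,
    gr i = Submodule.span F (Mmon '' { r | IsIdx p n r ∧ (normIdx n r : ℤ) = i + 2 })
  Mmon_Mx : ∀ j : Fin (2 * n),
    Mmon (fun i => if (i : ℕ) = (j : ℕ) then 1 else 0) = Mx j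
  Mmon_M1 : Mmon (fun _ => 0) = M1

namespace OddContactSetup

variable {F : Type u} [Field F] {g : Type v} [AddCommGroup g] [Module F g]
variable (S : OddContactSetup F g)

theorem gr_le_filt {i j : ℤ} (h : i ≤ j) : S.gr j ≤ S.filt i :=
  le_iSup₂_of_le (f := fun j (_ : j ≥ i) => S.gr j) j h le_rfl

theorem filt_anti {i j : ℤ} (h : i ≤ j) : S.filt j ≤ S.filt i :=
  iSup₂_le fun _ hk => S.gr_le_filt (le_trans h hk)

theorem filt_split (i : ℤ) : S.filt i = S.gr i ⊔ S.filt (i + 1) := by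
  apply le_antisymm
  · refine iSup₂_le fun k hk => ?_
    rcases eq_or_lt_of_le hk with h | h
    · subst h; exact le_sup_left
    · exact le_trans (S.gr_le_filt (by omega)) le_sup_right
  · exact sup_le (S.gr_le_filt le_rfl) (S.filt_anti (by omega))

theorem filt_br {i j : ℤ} {x y : g} (hx : x ∈ S.filt i) (hy : y ∈ S.filt j) :
    S.br x y ∈ S.filt (i + j) := by
  have h1 : ∀ k ≥ i, ∀ x ∈ S.gr k, S.filt j ≤ (S.filt (i + j)).comap (S.br x) := by
    intro k hk x hx
    refine iSup₂_le fun l hl y hy => ?_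
    have hl' : j ≤ l := hl
    have hk' : i ≤ k := hk
    exact S.gr_le_filt (by omega) (S.gr_br k l x hx y hy)
  have h2 : S.filt i ≤ (S.filt (i + j)).comap (S.br.flip y) :=
    iSup₂_le fun k hk x hx => h1 k hk x hx hy
  exact h2 hx

theorem ht_spec (χ : Module.Dual F g) (hht : 2 ≤ S.ht χ) :
    ∀ x ∈ S.filt (S.ht χ), χ x = 0 := by
  have hne : {i : ℤ | ∀ x ∈ S.filt i, χ x = 0}.Nonempty := by
    by_contra h
    rw [Set.not_nonempty_iff_eq_empty] at h
    rw [ht, h, Int.csInf_empty] at hht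
    omega
  have hb : BddBelow {i : ℤ | ∀ x ∈ S.filt i, χ x = 0} := by
    by_contra h
    rw [ht, Int.csInf_of_not_bddBelow h] at hht
    omega
  exact Int.csInf_mem hne hb

theorem aut_mem {Φ : g ≃ₗ[F] g} (hΦ : S.IsAut Φ) (i : ℤ) (x : g) :
    Φ x ∈ S.filt i ↔ x ∈ S.filt i := by
  constructor
  · intro h
    rw [← hΦ.map_filt i] at h
    obtain ⟨y, hy, hxy⟩ := h
    have : y = x := Φ.injective hxy
    exact this ▸ hy
  · intro h
    rw [← hΦ.map_filt i]
    exact ⟨x, h, rfl⟩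

theorem coad_apply (Φ : g ≃ₗ[F] g) (χ : Module.Dual F g) (x : g) :
    coad Φ χ (Φ x) = χ x := by
  simp [coad]

theorem ht_coad {Φ : g ≃ₗ[F] g} (hΦ : S.IsAut Φ) (χ : Module.Dual F g) :
    S.ht (coad Φ χ) = S.ht χ := by
  unfold ht
  congr 1
  ext i
  constructor
  · intro h x hx
    have := h (Φ x) ((S.aut_mem hΦ i x).2 hx)
    rwa [coad_apply] at this
  · intro h x hx
    obtain ⟨y, rfl⟩ := Φ.surjective x
    rw [coad_apply]
    exact h y ((S.aut_mem hΦ i y).1 hx)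

/-- The part of `g^h` orthogonal to `g^{-1}` under `χ([·,·])`. -/
def radChi (χ : Module.Dual F g) (h : ℤ) : Submodule F g :=
  S.filt h ⊓ ⨅ m ∈ S.filt (-1), LinearMap.ker (χ ∘ₗ S.br.flip m)

theorem mem_radChi (χ : Module.Dual F g) (h : ℤ) (u : g) :
    u ∈ S.radChi χ h ↔ u ∈ S.filt h ∧ ∀ m ∈ S.filt (-1), χ (S.br u m) = 0 := by
  simp [radChi]

theorem rank_first (χ : Module.Dual F g) (h : ℤ) (hχ : ∀ x ∈ S.filt h, χ x = 0) :
    Module.finrank F (Submodule.map (S.chiMap χ) (S.gr h)) +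
      Module.finrank F (S.radChi χ h) = Module.finrank F (S.filt h) := by
  have := S.findim
  have e1 : Submodule.map (S.chiMap χ) (S.gr h) = Submodule.map (S.chiMap χ) (S.filt h) := by
    rw [S.filt_split h, Submodule.map_sup]
    refine (sup_eq_left.2 (le_trans ?_ bot_le)).symm
    rintro _ ⟨u, hu, rfl⟩
    rw [Submodule.mem_bot]
    funext j
    have h1 := S.filt_br hu (S.gr_le_filt le_rfl (S.Mx_gr j))
    have h2 := hχ _ (by simpa using h1)
    simpa [chiMap] using h2
  have e2 : S.radChi χ h =
      Submodule.map (S.filt h).subtype (LinearMap.ker ((S.chiMap χ).domRestrict (S.filt h))) := by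
    ext u
    rw [mem_radChi, Submodule.mem_map]
    constructor
    · rintro ⟨hu, hm⟩
      refine ⟨⟨u, hu⟩, ?_, rfl⟩
      rw [LinearMap.mem_ker]
      funext j
      simpa [chiMap] using hm _ (S.gr_le_filt le_rfl (S.Mx_gr j))
    · rintro ⟨⟨u', hu⟩, hk, rfl⟩
      refine ⟨hu, fun m hm => ?_⟩
      have hle : S.filt (-1) ≤ LinearMap.ker (χ ∘ₗ S.br u') := by
        rw [S.filt_split, ← S.Mx_basis]
        refine sup_le (Submodule.span_le.2 ?_) ?_
        · rintro _ ⟨j, rfl⟩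
          have := congrFun (LinearMap.mem_ker.1 hk) j
          simpa [chiMap] using this
        · intro m hm
          have := S.filt_br hu hm
          exact hχ _ (by simpa using this)
      exact hle hm
  rw [e1, e2, LinearEquiv.finrank_eq
    (Submodule.equivMapOfInjective _ (S.filt h).injective_subtype _).symm,
    ← LinearMap.finrank_range_add_finrank_ker ((S.chiMap χ).domRestrict (S.filt h)),
    LinearMap.range_domRestrict]

theorem rad_coad {Φ : g ≃ₗ[F] g} (hΦ : S.IsAut Φ) (χ : Module.Dual F g) (h : ℤ) :
    S.radChi (coad Φ χ) h = Submodule.map Φ.toLinearMap (S.radChi χ h) := by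
  ext u
  obtain ⟨u, rfl⟩ := Φ.surjective u
  have e : Φ u ∈ Submodule.map Φ.toLinearMap (S.radChi χ h) ↔ u ∈ S.radChi χ h := by
    constructor
    · rintro ⟨y, hy, hxy⟩
      have : y = u := Φ.injective hxy
      exact this ▸ hy
    · intro hu
      exact ⟨u, hu, rfl⟩
  rw [e, mem_radChi, mem_radChi, S.aut_mem hΦ]
  refine and_congr_right fun _ => ?_
  constructor
  · intro H m hm
    have := H (Φ m) ((S.aut_mem hΦ _ m).2 hm)
    rwa [← hΦ.map_br, coad_apply] at this
  · intro H m hm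
    obtain ⟨m, rfl⟩ := Φ.surjective m
    rw [← hΦ.map_br, coad_apply]
    exact H m ((S.aut_mem hΦ _ m).1 hm)

theorem second_iff (χ : Module.Dual F g) (h : ℤ) (hχ : ∀ x ∈ S.filt h, χ x = 0) :
    (∃ u ∈ S.gr (h + 1), χ (S.br u S.M1) ≠ 0) ↔
      ∃ u ∈ S.filt (h + 1), ∃ m ∈ S.filt (-2), χ (S.br u m) ≠ 0 := by
  constructor
  · rintro ⟨u, hu, hne⟩
    exact ⟨u, S.gr_le_filt le_rfl hu, S.M1, S.gr_le_filt le_rfl S.M1_gr, hne⟩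
  · rintro ⟨u, hu, m, hm, hne⟩
    by_contra! H
    apply hne
    have hle : S.filt (h + 1) ≤ LinearMap.ker (χ ∘ₗ S.br.flip S.M1) := by
      rw [S.filt_split]
      refine sup_le (fun u hu => by simpa using H u hu) fun u hu => ?_
      have h1 := S.filt_br hu (S.gr_le_filt le_rfl S.M1_gr)
      exact hχ _ (by simpa [add_assoc] using h1)
    have hle2 : S.filt (-2) ≤ LinearMap.ker (χ ∘ₗ S.br u) := by
      rw [S.filt_split, ← S.M1_span]
      refine sup_le (Submodule.span_le.2 ?_) ?_
      · rintro _ rfl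
        exact hle hu
      · intro m hm
        have := S.filt_br hu hm
        exact hχ _ (by simpa using this)
    exact hle2 hm

theorem second_coad {Φ : g ≃ₗ[F] g} (hΦ : S.IsAut Φ) (χ : Module.Dual F g) (h : ℤ) :
    (∃ u ∈ S.filt (h + 1), ∃ m ∈ S.filt (-2), coad Φ χ (S.br u m) ≠ 0) ↔
      ∃ u ∈ S.filt (h + 1), ∃ m ∈ S.filt (-2), χ (S.br u m) ≠ 0 := by
  constructor
  · rintro ⟨u, hu, m, hm, hne⟩
    obtain ⟨u, rfl⟩ := Φ.surjective u
    obtain ⟨m, rfl⟩ := Φ.surjective m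
    rw [← hΦ.map_br, coad_apply] at hne
    exact ⟨u, (S.aut_mem hΦ _ u).1 hu, m, (S.aut_mem hΦ _ m).1 hm, hne⟩
  · rintro ⟨u, hu, m, hm, hne⟩
    refine ⟨Φ u, (S.aut_mem hΦ _ u).2 hu, Φ m, (S.aut_mem hΦ _ m).2 hm, ?_⟩
    rwa [← hΦ.map_br, coad_apply]

end OddContactSetup

open OddContactSetup in
/-- Proposition 3.1: `rank(Φ·χ) = rank(χ)` for any automorphism `Φ`. -/
theorem stmt_9
    {F : Type u} [Field F] {g : Type v} [AddCommGroup g] [Module F g]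
    (S : OddContactSetup F g)
    (χ : Module.Dual F g) (hχodd : ∀ x ∈ S.odd, χ x = 0)
    (hht : 2 ≤ S.ht χ)
    (Φ : g ≃ₗ[F] g) (hΦ : S.IsAut Φ) :
    S.rankChi (coad Φ χ) = S.rankChi χ := by
  have hχ := S.ht_spec χ hht
  have hht' : S.ht (coad Φ χ) = S.ht χ := S.ht_coad hΦ χ
  have hχ' : ∀ x ∈ S.filt (S.ht χ), coad Φ χ x = 0 := by
    have := S.ht_spec (coad Φ χ) (by rw [hht']; exact hht)
    rwa [hht'] at this
  have h1 := S.rank_first χ _ hχ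
  have h2 := S.rank_first (coad Φ χ) _ hχ'
  rw [S.rad_coad hΦ, LinearEquiv.finrank_map_eq Φ] at h2
  have h3 := (S.second_iff (coad Φ χ) _ hχ').trans
    ((S.second_coad hΦ χ _).trans (S.second_iff χ _ hχ).symm)
  unfold rankChi
  rw [hht']
  by_cases hc : ∃ u ∈ S.gr (S.ht χ + 1), χ (S.br u S.M1) ≠ 0
  · rw [if_pos hc, if_pos (h3.2 hc)]
    omega
  · rw [if_neg hc, if_neg (fun h => hc (h3.1 h))]
    omega
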